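/- Let ω ∈ S_n and let 1 ≤ i < j ≤ n be such that j − i ≤ #{k ∈ [i] : ω⁻¹(k) < ω⁻¹(j)}. Then in every acyclic reduced pipe dream P ∈ Π(ω), the pipes i and j are comparable for ⪯_P: either i ⪯_P j or j ⪯_P i. -/

import Mathlib

/-- A pipe dream of size `n` on the triangular shape, with boxes indexed by pairs
`(r, c)` of a row `r` and a column `c`, both `0`-indexed (rows increase southwards,
columns increase eastwards).  `cross r c = true` means that box `(r, c)` contains a
crossing tile; all other boxes contain elbow tiles.  Crossings are only allowed in
the full boxes of the triangular shape, i.e. those with `r + c + 2 ≤ n` (the boxes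
with `r + c + 1 = n` are the half-boxes on the antidiagonal, which are forced
elbows).  The `n` pipes enter horizontally on the left side in rows `0, …, n-1` and
exit vertically on the top side in columns `0, …, n-1`; pipe `k` is the pipe
entering at row `k`.  An elbow tile connects the west edge of its box to the north
edge (the pipe travelling through this elbow passes northwest of the tile) and the
south edge to the east edge (this pipe passes southeast of the tile); a crossing
tile connects west to east and south to north. -/
structure PipeDream (n : ℕ) where
  cross : ℕ → ℕ → Bool
  inShape : ∀ r c : ℕ, cross r c = true → r + c + 2 ≤ n

namespace PipeDream

variable {n : ℕ}

/-- `(P.pipes r c).1` is the label of the pipe entering box `(r, c)` from the west,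
and `(P.pipes r c).2` is the label of the pipe entering box `(r, c)` from the south
(junk value `0` if there is no box below box `(r, c)` in the triangular shape). -/
def pipes (P : PipeDream n) : ℕ → ℕ → ℕ × ℕ
  | r, c =>
    (if hc : c = 0 then r
      else if P.cross r (c - 1) then (pipes P r (c - 1)).1 else (pipes P r (c - 1)).2,
     if hr : r + c + 2 ≤ n then
        if P.cross (r + 1) c then (pipes P (r + 1) c).2 else (pipes P (r + 1) c).1
      else 0)
  termination_by r c => (n - r) + c
  decreasing_by all_goals omega

/-- The pipe entering box `(r, c)` from the west (travelling eastwards). -/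
def west (P : PipeDream n) (r c : ℕ) : ℕ := (pipes P r c).1

/-- The pipe entering box `(r, c)` from the south (travelling northwards). -/
def south (P : PipeDream n) (r c : ℕ) : ℕ := (pipes P r c).2

/-- The pipe exiting on the top side at column `c`. -/
def exitPipe (P : PipeDream n) (c : ℕ) : ℕ :=
  if P.cross 0 c then P.south 0 c else P.west 0 c

/-- `P` has exit permutation `ω`, i.e. the pipe exiting at column `c` is `ω c`;
equivalently, pipe `k` exits at column `ω⁻¹ k`. -/
def HasExitPerm (P : PipeDream n) (ω : Equiv.Perm (Fin n)) : Prop :=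
  ∀ c : Fin n, P.exitPipe c.val = (ω c).val

/-- `P` is reduced: any two of its pipes cross at most once. -/
def Reduced (P : PipeDream n) : Prop :=
  ∀ r c r' c' : ℕ, P.cross r c = true → P.cross r' c' = true → (r, c) ≠ (r', c') →
    ¬ ((P.west r c = P.west r' c' ∧ P.south r c = P.south r' c') ∨
        (P.west r c = P.south r' c' ∧ P.south r c = P.west r' c'))

/-- The arcs of the contact graph `P♯` of `P`: there is one arc for each elbow
contact of `P` (an elbow tile in a full box of the triangular shape), oriented from
the pipe passing northwest of the contact (the one travelling west-to-north) to the
pipe passing southeast of it (the one travelling south-to-east). -/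
def Arc (P : PipeDream n) (i j : ℕ) : Prop :=
  ∃ r c : ℕ, r + c + 2 ≤ n ∧ P.cross r c = false ∧ P.west r c = i ∧ P.south r c = j

/-- `P` is acyclic: its contact graph has no directed cycle. -/
def Acyclic (P : PipeDream n) : Prop := ∀ i : ℕ, ¬ Relation.TransGen P.Arc i i

/-- `i ⪯_P j` : there is a directed path (possibly empty) from `i` to `j` in the
contact graph of `P`. -/
def Path (P : PipeDream n) (i j : ℕ) : Prop := Relation.ReflTransGen P.Arc i j

/-- `π` is a linear extension of `P` : `π⁻¹ i < π⁻¹ j` for every arc `i → j` of the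
contact graph of `P`. -/
def LinExt (P : PipeDream n) (π : Equiv.Perm (Fin n)) : Prop :=
  ∀ i j : Fin n, P.Arc i.val j.val → π⁻¹ i < π⁻¹ j

/-- There is a contact (an elbow tile in a full box) between pipes `i` and `j`
at box `b`. -/
def ContactAt (P : PipeDream n) (i j : ℕ) (b : ℕ × ℕ) : Prop :=
  b.1 + b.2 + 2 ≤ n ∧ P.cross b.1 b.2 = false ∧
    ((P.west b.1 b.2 = i ∧ P.south b.1 b.2 = j) ∨
      (P.west b.1 b.2 = j ∧ P.south b.1 b.2 = i))

/-- `P'` is obtained from `P` by the flip exchanging the contact at box `b` with the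
crossing at box `b'` (a contact and a crossing between the same two pipes). -/
def IsFlip (P P' : PipeDream n) (b b' : ℕ × ℕ) : Prop :=
  b ≠ b' ∧
  P.cross b.1 b.2 = false ∧ P.cross b'.1 b'.2 = true ∧
  P'.cross b.1 b.2 = true ∧ P'.cross b'.1 b'.2 = false ∧
  (∀ r c : ℕ, (r, c) ≠ b → (r, c) ≠ b' → P.cross r c = P'.cross r c) ∧
  ((P.west b.1 b.2 = P.west b'.1 b'.2 ∧ P.south b.1 b.2 = P.south b'.1 b'.2) ∨
    (P.west b.1 b.2 = P.south b'.1 b'.2 ∧ P.south b.1 b.2 = P.west b'.1 b'.2))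

/-- There is an increasing flip from `P` to `P'`: a flip exchanging a contact at a
box `b` weakly southwest of the box `b'` of the corresponding crossing. -/
def IncFlip (P P' : PipeDream n) : Prop :=
  ∃ b b' : ℕ × ℕ, P.IsFlip P' b b' ∧ b'.1 ≤ b.1 ∧ b.2 ≤ b'.2

end PipeDream

/-- The weak order on permutations of `Fin n` : `π ≤ σ` if and only if
`Inv(π) ⊆ Inv(σ)`, where `Inv(π)` is the set of pairs `(i, j)` with `i < j` and
`π⁻¹ i > π⁻¹ j`. -/
def WeakLE {n : ℕ} (π σ : Equiv.Perm (Fin n)) : Prop :=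
  ∀ i j : Fin n, i < j → π⁻¹ j < π⁻¹ i → σ⁻¹ j < σ⁻¹ i

namespace PipeDream

variable {n : ℕ}

theorem west_zero (P : PipeDream n) (r : ℕ) : P.west r 0 = r := by
  unfold west; rw [pipes]; simp

theorem west_succ_cross (P : PipeDream n) {r c : ℕ} (h : P.cross r c = true) :
    P.west r (c + 1) = P.west r c := by
  unfold west; rw [pipes]; simp [h]

theorem west_succ_elbow (P : PipeDream n) {r c : ℕ} (h : P.cross r c = false) :
    P.west r (c + 1) = P.south r c := by
  unfold west south; rw [pipes]; simp [h]

/-- the pipe leaving box `(r, c)` northwards -/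
def north (P : PipeDream n) (r c : ℕ) : ℕ :=
  if P.cross r c then P.south r c else P.west r c

theorem north_cross (P : PipeDream n) {r c : ℕ} (h : P.cross r c = true) :
    P.north r c = P.south r c := by simp [north, h]

theorem north_elbow (P : PipeDream n) {r c : ℕ} (h : P.cross r c = false) :
    P.north r c = P.west r c := by simp [north, h]

theorem south_eq (P : PipeDream n) {r c : ℕ} (h : r + c + 2 ≤ n) :
    P.south r c = P.north (r + 1) c := by
  unfold south north west; rw [pipes]; simp [h]; rfl

theorem elbow_of (P : PipeDream n) {r c : ℕ} (h : ¬ r + c + 2 ≤ n) : P.cross r c = false := by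
  by_contra hc
  exact h (P.inShape r c (by simpa using hc))

/-! ### Order of pipes along the sweep -/

/-- the pipe at level `l` after processing the boxes of columns `< c` and the boxes of
column `c` in rows `≥ r` -/
def slot (P : PipeDream n) (c r l : ℕ) : ℕ :=
  if l < c then P.north 0 l else if l < c + r then P.west (l - c) c
  else if l = c + r then P.north r c else P.west (l - c - 1) (c + 1)

def Ord (P : PipeDream n) (a b c r : ℕ) : Prop :=
  ∃ l l' : ℕ, l < l' ∧ l' < n ∧ P.slot c r l = a ∧ P.slot c r l' = b

theorem slot_a (P : PipeDream n) (c r : ℕ) : P.slot c (r + 1) (c + r) = P.west r c := by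
  simp [slot]

theorem slot_b (P : PipeDream n) {c r : ℕ} (h : r + c + 2 ≤ n) :
    P.slot c (r + 1) (c + r + 1) = P.south r c := by
  rw [south_eq P h]; unfold slot
  rw [if_neg (by omega), if_neg (by omega), if_pos (by omega)]

theorem slot_c (P : PipeDream n) (c r : ℕ) : P.slot c r (c + r) = P.north r c := by
  simp [slot]

theorem slot_d (P : PipeDream n) (c r : ℕ) : P.slot c r (c + r + 1) = P.west r (c + 1) := by
  unfold slot
  rw [if_neg (by omega), if_neg (by omega), if_neg (by omega)]
  congr 1; omega

theorem slot_e (P : PipeDream n) (c r l : ℕ) (h1 : l ≠ c + r) (h2 : l ≠ c + r + 1) :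
    P.slot c (r + 1) l = P.slot c r l := by
  unfold slot
  split_ifs <;> first | rfl | omega

theorem slot_elbow (P : PipeDream n) {c r : ℕ} (h : r + c + 2 ≤ n) (hx : P.cross r c = false)
    (l : ℕ) : P.slot c (r + 1) l = P.slot c r l := by
  by_cases h1 : l = c + r
  · subst h1; rw [slot_a, slot_c, north_elbow P hx]
  by_cases h2 : l = c + r + 1
  · subst h2; rw [slot_b P h, slot_d, west_succ_elbow P hx]
  exact slot_e P c r l h1 h2

theorem slot_swap (P : PipeDream n) {c r : ℕ} (h : r + c + 2 ≤ n) (hx : P.cross r c = true)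
    (l : ℕ) : P.slot c (r + 1) l = P.slot c r (Equiv.swap (c + r) (c + r + 1) l) := by
  by_cases h1 : l = c + r
  · subst h1; rw [slot_a, Equiv.swap_apply_left, slot_d, west_succ_cross P hx]
  by_cases h2 : l = c + r + 1
  · subst h2; rw [slot_b P h, Equiv.swap_apply_right, slot_c, north_cross P hx]
  rw [Equiv.swap_apply_of_ne_of_ne h1 h2]
  exact slot_e P c r l h1 h2

theorem swap_lt {x l l' m : ℕ} (h : l < l') (hm : l' < m) (hx : x + 1 < m)
    (hne : ¬ (l = x ∧ l' = x + 1)) :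
    Equiv.swap x (x + 1) l < Equiv.swap x (x + 1) l' ∧ Equiv.swap x (x + 1) l' < m := by
  simp only [Equiv.swap_apply_def]
  split_ifs <;> omega

theorem ord_fwd (P : PipeDream n) {a b c r : ℕ} (h : r + c + 2 ≤ n) (ho : P.Ord a b c (r + 1))
    (hn : ¬ (P.cross r c = true ∧ P.west r c = a ∧ P.south r c = b)) : P.Ord a b c r := by
  obtain ⟨l, l', h1, h2, h3, h4⟩ := ho
  cases hx : P.cross r c
  · exact ⟨l, l', h1, h2, by rw [← slot_elbow P h hx, h3], by rw [← slot_elbow P h hx, h4]⟩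
  · rw [slot_swap P h hx] at h3 h4
    obtain ⟨h5, h6⟩ := swap_lt (x := c + r) h1 h2 (by omega) (by
      rintro ⟨rfl, rfl⟩
      rw [← slot_swap P h hx] at h3 h4
      rw [slot_a] at h3
      rw [slot_b P h] at h4
      exact hn ⟨hx, h3, h4⟩)
    exact ⟨_, _, h5, h6, h3, h4⟩

theorem ord_bwd (P : PipeDream n) {a b c r : ℕ} (h : r + c + 2 ≤ n) (ho : P.Ord a b c r)
    (hn : ¬ (P.cross r c = true ∧ P.west r c = b ∧ P.south r c = a)) : P.Ord a b c (r + 1) := by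
  obtain ⟨l, l', h1, h2, h3, h4⟩ := ho
  cases hx : P.cross r c
  · exact ⟨l, l', h1, h2, by rw [slot_elbow P h hx, h3], by rw [slot_elbow P h hx, h4]⟩
  · obtain ⟨h5, h6⟩ := swap_lt (x := c + r) h1 h2 (by omega) (by
      rintro ⟨rfl, rfl⟩
      rw [slot_c, north_cross P hx] at h3
      rw [slot_d, west_succ_cross P hx] at h4
      exact hn ⟨hx, h4, h3⟩)
    refine ⟨_, _, h5, h6, ?_, ?_⟩
    · rw [slot_swap P h hx, Equiv.swap_apply_self, h3]
    · rw [slot_swap P h hx, Equiv.swap_apply_self, h4]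

theorem slot_next (P : PipeDream n) {c l m : ℕ} (hm : c + m + 2 = n) (hl : l < n) :
    P.slot c 0 l = P.slot (c + 1) m l := by
  unfold slot
  by_cases h1 : l < c
  · rw [if_pos h1, if_pos (by omega)]
  by_cases h2 : l = c
  · subst h2; simp
  rw [if_neg h1, if_neg (by omega), if_neg (by omega), if_neg (by omega)]
  by_cases h3 : l = c + 1 + m
  · rw [if_neg (by omega), if_pos h3, north_elbow P (P.elbow_of (by omega))]
    congr 1; omega
  · rw [if_pos (by omega)]
    congr 1

theorem ord_next (P : PipeDream n) {a b c m : ℕ} (hm : c + m + 2 = n) :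
    P.Ord a b c 0 ↔ P.Ord a b (c + 1) m := by
  constructor
  · rintro ⟨l, l', h1, h2, h3, h4⟩
    exact ⟨l, l', h1, h2, by rw [← slot_next P hm (by omega), h3],
      by rw [← slot_next P hm (by omega), h4]⟩
  · rintro ⟨l, l', h1, h2, h3, h4⟩
    exact ⟨l, l', h1, h2, by rw [slot_next P hm (by omega), h3],
      by rw [slot_next P hm (by omega), h4]⟩

theorem cross_uniq (P : PipeDream n) (hred : P.Reduced) {r c r' c' a b : ℕ}
    (hx : P.cross r c = true) (hx' : P.cross r' c' = true)
    (hne : r ≠ r' ∨ c ≠ c') (hw : P.west r c = a) (hs : P.south r c = b) :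
    ¬ (P.west r' c' = a ∧ P.south r' c' = b) ∧ ¬ (P.west r' c' = b ∧ P.south r' c' = a) := by
  have h := hred r c r' c' hx hx' (by simp only [ne_eq, Prod.mk.injEq]; omega)
  constructor
  · rintro ⟨h1, h2⟩; exact h (Or.inl ⟨by rw [hw, h1], by rw [hs, h2]⟩)
  · rintro ⟨h1, h2⟩; exact h (Or.inr ⟨by rw [hw, h2], by rw [hs, h1]⟩)

theorem ord_col_down (P : PipeDream n) {a b c r : ℕ} (ho : P.Ord a b c r) (hr : r + c + 1 ≤ n)
    (hn : ∀ r', r' < r → ¬ (P.cross r' c = true ∧ P.west r' c = a ∧ P.south r' c = b)) :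
    P.Ord a b c 0 := by
  induction r with
  | zero => exact ho
  | succ k ih =>
    exact ih (ord_fwd P (by omega) ho (hn k (by omega))) (by omega) fun r' h => hn r' (by omega)

theorem ord_col_up (P : PipeDream n) {a b c r : ℕ} (ho : P.Ord a b c r) (m : ℕ)
    (hr : r + m + c + 1 ≤ n)
    (hn : ∀ r', r ≤ r' → ¬ (P.cross r' c = true ∧ P.west r' c = b ∧ P.south r' c = a)) :
    P.Ord a b c (r + m) := by
  induction m with
  | zero => exact ho
  | succ k ih => exact ord_bwd P (r := r + k) (by omega) (ih (by omega)) (hn (r + k) (by omega))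

theorem cross_order (P : PipeDream n) (hred : P.Reduced) {r c a b : ℕ}
    (hx : P.cross r c = true) (hw : P.west r c = a) (hs : P.south r c = b) :
    a < b ∧ ∃ l l', l < l' ∧ l' < n ∧ P.exitPipe l = b ∧ P.exitPipe l' = a := by
  have hsh := P.inShape r c hx
  constructor
  · have h0 : P.Ord a b c (r + 1) :=
      ⟨c + r, c + r + 1, by omega, by omega, by rw [slot_a, hw], by rw [slot_b P hsh, hs]⟩
    have h1 : P.Ord a b c (n - 1 - c) := by
      have := ord_col_up P h0 (n - 1 - c - (r + 1)) (by omega) (fun r' hr' h =>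
        (cross_uniq P hred hx h.1 (by omega) hw hs).2 h.2)
      rwa [show r + 1 + (n - 1 - c - (r + 1)) = n - 1 - c by omega] at this
    have h2 : ∀ k, k ≤ c → P.Ord a b (c - k) (n - 1 - (c - k)) := by
      intro k
      induction k with
      | zero => intro _; exact h1
      | succ k ih =>
        intro hk
        have h3 := ih (by omega)
        rw [show c - k = (c - (k + 1)) + 1 by omega] at h3
        have h4 := (ord_next P (a := a) (b := b) (c := c - (k + 1))
          (m := n - 1 - (c - (k + 1) + 1)) (by omega)).2 h3
        have := ord_col_up P h4 (n - 1 - (c - (k + 1))) (by omega) (fun r' hr' h =>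
          (cross_uniq P hred hx h.1 (by omega) hw hs).2 h.2)
        rwa [Nat.zero_add] at this
    have h3 := h2 c le_rfl
    rw [Nat.sub_self] at h3
    obtain ⟨l, l', h4, h5, h6, h7⟩ := h3
    have key : ∀ l, l < n → P.slot 0 (n - 1 - 0) l = l := by
      intro l hl
      unfold slot
      rw [if_neg (by omega)]
      split_ifs with h h'
      · rw [west_zero]; omega
      · rw [north_elbow P (P.elbow_of (by omega)), west_zero]; omega
      · omega
    rw [key _ (by omega)] at h6 h7
    omega
  · have h0 : P.Ord b a c r :=
      ⟨c + r, c + r + 1, by omega, by omega, by rw [slot_c, north_cross P hx, hs],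
        by rw [slot_d, west_succ_cross P hx, hw]⟩
    have h1 : P.Ord b a c 0 := ord_col_down P h0 (by omega) (fun r' hr' h =>
        (cross_uniq P hred hx h.1 (by omega) hw hs).2 h.2)
    have h2 : ∀ k, c + k + 1 ≤ n → P.Ord b a (c + k) 0 := by
      intro k
      induction k with
      | zero => intro _; exact h1
      | succ k ih =>
        intro hk
        have h3 := (ord_next P (a := b) (b := a) (c := c + k)
          (m := n - (c + k) - 2) (by omega)).1 (ih (by omega))
        exact ord_col_down P h3 (by omega) (fun r' hr' h =>
          (cross_uniq P hred hx h.1 (by omega) hw hs).2 h.2)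
    obtain ⟨l, l', h4, h5, h6, h7⟩ := h2 (n - 1 - c) (by omega)
    have key : ∀ l, l < n → P.slot (c + (n - 1 - c)) 0 l = P.exitPipe l := by
      intro l hl
      unfold slot
      by_cases h : l < c + (n - 1 - c)
      · rw [if_pos h]; rfl
      · have : l = c + (n - 1 - c) := by omega
        rw [if_neg h, if_neg (by omega), if_pos (by omega), ← this]; rfl
    rw [key _ (by omega)] at h6 h7
    exact ⟨l, l', h4, h5, h6, h7⟩

/-! ### Following pipes -/

theorem follow_east (P : PipeDream n) {r c p : ℕ} (hs : r + c + 1 ≤ n) (hw : P.west r c = p) :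
    ∃ e, c ≤ e ∧ r + e + 1 ≤ n ∧ P.cross r e = false ∧
      (∀ c', c ≤ c' → c' ≤ e → P.west r c' = p) ∧
      (∀ c', c ≤ c' → c' < e → P.cross r c' = true) := by
  induction hk : n - c generalizing c with
  | zero => omega
  | succ k ih =>
    cases hx : P.cross r c
    · refine ⟨c, le_rfl, hs, hx, ?_, ?_⟩
      · intro c' h1 h2
        rw [show c' = c by omega, hw]
      · intro c' h1 h2; omega
    · have := P.inShape r c hx
      obtain ⟨e, h1, h2, h3, h4, h5⟩ := ih (c := c + 1) (by omega)
        (by rw [west_succ_cross P hx, hw]) (by omega)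
      refine ⟨e, by omega, h2, h3, ?_, ?_⟩
      · intro c' h6 h7
        by_cases h : c' = c
        · rw [h, hw]
        · exact h4 c' (by omega) h7
      · intro c' h6 h7
        by_cases h : c' = c
        · rw [h, hx]
        · exact h5 c' (by omega) h7

theorem up_of_west (P : PipeDream n) {r c p : ℕ} (hs : r + 1 + c + 1 ≤ n)
    (hw : P.west (r + 1) c = p) :
    ∃ c', c ≤ c' ∧ r + c' + 2 ≤ n ∧ P.south r c' = p := by
  obtain ⟨e, h1, h2, h3, h4, -⟩ := follow_east P hs hw
  exact ⟨e, h1, by omega, by rw [south_eq P (by omega), north_elbow P h3, h4 e h1 le_rfl]⟩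

theorem up_of_south (P : PipeDream n) {r c p : ℕ} (hs : r + 1 + c + 2 ≤ n)
    (hw : P.south (r + 1) c = p) :
    ∃ c', c ≤ c' ∧ r + c' + 2 ≤ n ∧ P.south r c' = p := by
  cases hx : P.cross (r + 1) c
  · obtain ⟨c', h1, h2, h3⟩ := up_of_west P (r := r) (c := c + 1) (p := p) (by omega)
      (by rw [west_succ_elbow P hx, hw])
    exact ⟨c', by omega, h2, h3⟩
  · exact ⟨c, le_rfl, by omega, by rw [south_eq P (by omega), north_cross P hx, hw]⟩

theorem up_many (P : PipeDream n) {r c p : ℕ} (k : ℕ) (hs : r + (k + 1) + c + 1 ≤ n)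
    (hw : P.west (r + (k + 1)) c = p) :
    ∃ c', c ≤ c' ∧ r + c' + 2 ≤ n ∧ P.south r c' = p := by
  induction k generalizing r with
  | zero => exact up_of_west P hs hw
  | succ k ih =>
    obtain ⟨c', h1, h2, h3⟩ := ih (r := r + 1) (by omega)
      (by rw [show r + 1 + (k + 1) = r + (k + 1 + 1) by omega, hw])
    obtain ⟨c'', h4, h5, h6⟩ := up_of_south P h2 h3
    exact ⟨c'', by omega, h5, h6⟩

theorem up_to (P : PipeDream n) {r r' c p : ℕ} (hr : r < r') (hs : r' + c + 1 ≤ n)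
    (hw : P.west r' c = p) :
    ∃ c', c ≤ c' ∧ r + c' + 2 ≤ n ∧ P.south r c' = p :=
  up_many P (r' - r - 1) (by omega) (by rw [show r + (r' - r - 1 + 1) = r' by omega, hw])

theorem south_from (P : PipeDream n) {r c p : ℕ} (hs : r + c + 2 ≤ n) (h : P.south r c = p) :
    ∃ r', r < r' ∧ r' + c + 1 ≤ n ∧ P.west r' c = p := by
  induction hk : n - r generalizing r with
  | zero => omega
  | succ k ih =>
    rw [south_eq P hs] at h
    cases hx : P.cross (r + 1) c
    · rw [north_elbow P hx] at h
      exact ⟨r + 1, by omega, by omega, h⟩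
    · rw [north_cross P hx] at h
      have := P.inShape _ _ hx
      obtain ⟨r', h1, h2, h3⟩ := ih this h (by omega)
      exact ⟨r', by omega, h2, h3⟩

theorem straight_up (P : PipeDream n) {r c p : ℕ} (hs : r + c + 2 ≤ n) (h : P.south r c = p) :
    (∃ q, q ≤ r ∧ P.cross q c = false ∧ P.south q c = p ∧
      ∀ q', q < q' → q' ≤ r → P.cross q' c = true) ∨
    (∀ q, q ≤ r → P.cross q c = true ∧ P.south q c = p) := by
  induction r with
  | zero =>
    cases hx : P.cross 0 c
    · exact Or.inl ⟨0, le_rfl, hx, h, fun q' h1 h2 => by omega⟩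
    · right
      intro q hq
      rw [show q = 0 by omega]
      exact ⟨hx, h⟩
  | succ r ih =>
    cases hx : P.cross (r + 1) c
    · exact Or.inl ⟨r + 1, le_rfl, hx, h, fun q' h1 h2 => by omega⟩
    · rcases ih (by omega) (by rw [south_eq P (by omega), north_cross P hx, h]) with
        ⟨q, h1, h2, h3, h4⟩ | h1
      · refine Or.inl ⟨q, by omega, h2, h3, fun q' h5 h6 => ?_⟩
        by_cases h7 : q' = r + 1
        · rw [h7, hx]
        · exact h4 q' h5 (by omega)
      · right
        intro q hq
        by_cases h7 : q = r + 1
        · rw [h7]; exact ⟨hx, h⟩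
        · exact h1 q (by omega)

/-! ### Hooks: above a hook of a reduced pipe dream, all boxes are crossings -/

theorem hook_full (P : PipeDream n) (hred : P.Reduced) {b r r2 c e : ℕ} (hr : r < r2)
    (hs : r2 + e + 1 ≤ n) (hce : c < e)
    (hrow : ∀ c', c ≤ c' → c' < e → P.cross r2 c' = true ∧ P.west r2 c' = b)
    (hcol : ∀ r', r ≤ r' → r' < r2 → P.cross r' e = true ∧ P.south r' e = b) :
    P.cross r c = true := by
  have hright : ∀ r', r ≤ r' → r' < r2 →
      ∀ y, P.cross r2 y = true → P.west r2 y = b → P.south r2 y ≠ P.west r' e := by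
    intro r' h1 h2 y h3 h4 h5
    obtain ⟨h6, h7⟩ := hcol r' h1 h2
    exact (cross_uniq P hred h3 h6 (by omega) h4 h5).2 ⟨rfl, h7⟩
  let X : ℕ → Prop := fun p => ∃ y, P.cross r2 y = true ∧ P.west r2 y = b ∧ P.south r2 y = p
  have main : ∀ k r', r' + k + 1 = r2 → r ≤ r' → (∀ c', c ≤ c' → c' < e → X (P.south r' c')) ∧
      (∀ c', c ≤ c' → c' < e → P.cross r' c' = true) := by
    intro k
    induction k with
    | zero =>
      intro r' h1 h2
      have hX : ∀ c', c ≤ c' → c' < e → X (P.south r' c') := by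
        intro c' h3 h4
        obtain ⟨h5, h6⟩ := hrow c' h3 h4
        refine ⟨c', h5, h6, ?_⟩
        rw [south_eq P (r := r') (by omega), show r' + 1 = r2 by omega, north_cross P h5]
      refine ⟨hX, ?_⟩
      have : ∀ m c', c' + m + 1 = e → c ≤ c' → ¬ X (P.west r' (c' + 1)) ∧ P.cross r' c' = true := by
        intro m
        induction m with
        | zero =>
          intro c' h3 h4
          have hnX : ¬ X (P.west r' (c' + 1)) := by
            rw [show c' + 1 = e by omega]
            rintro ⟨y, h5, h6, h7⟩
            exact hright r' h2 (by omega) y h5 h6 h7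
          refine ⟨hnX, ?_⟩
          by_contra hx
          have hx : P.cross r' c' = false := by simpa using hx
          rw [west_succ_elbow P hx] at hnX
          exact hnX (hX c' h4 (by omega))
        | succ m ih =>
          intro c' h3 h4
          obtain ⟨h5, h6⟩ := ih (c' + 1) (by omega) (by omega)
          rw [west_succ_cross P h6] at h5
          refine ⟨h5, ?_⟩
          by_contra hx
          have hx : P.cross r' c' = false := by simpa using hx
          rw [west_succ_elbow P hx] at h5
          exact h5 (hX c' h4 (by omega))
      intro c' h3 h4
      exact (this (e - c' - 1) c' (by omega) h3).2
    | succ k ihk =>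
      intro r' h1 h2
      obtain ⟨hX0, hC0⟩ := ihk (r' + 1) (by omega) (by omega)
      have hX : ∀ c', c ≤ c' → c' < e → X (P.south r' c') := by
        intro c' h3 h4
        rw [south_eq P (by omega), north_cross P (hC0 c' h3 h4)]
        exact hX0 c' h3 h4
      refine ⟨hX, ?_⟩
      have : ∀ m c', c' + m + 1 = e → c ≤ c' → ¬ X (P.west r' (c' + 1)) ∧ P.cross r' c' = true := by
        intro m
        induction m with
        | zero =>
          intro c' h3 h4
          have hnX : ¬ X (P.west r' (c' + 1)) := by
            rw [show c' + 1 = e by omega]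
            rintro ⟨y, h5, h6, h7⟩
            exact hright r' h2 (by omega) y h5 h6 h7
          refine ⟨hnX, ?_⟩
          by_contra hx
          have hx : P.cross r' c' = false := by simpa using hx
          rw [west_succ_elbow P hx] at hnX
          exact hnX (hX c' h4 (by omega))
        | succ m ih =>
          intro c' h3 h4
          obtain ⟨h5, h6⟩ := ih (c' + 1) (by omega) (by omega)
          rw [west_succ_cross P h6] at h5
          refine ⟨h5, ?_⟩
          by_contra hx
          have hx : P.cross r' c' = false := by simpa using hx
          rw [west_succ_elbow P hx] at h5
          exact h5 (hX c' h4 (by omega))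
      intro c' h3 h4
      exact (this (e - c' - 1) c' (by omega) h3).2
  exact (main (r2 - r - 1) r (by omega) le_rfl).2 c le_rfl hce

/-! ### Down-closed sets of pipes -/

/-- `B` is closed under predecessors in the contact graph -/
def Down (P : PipeDream n) (B : ℕ → Prop) : Prop := ∀ x y, P.Arc x y → B y → B x

theorem down_west (P : PipeDream n) {B : ℕ → Prop} (hB : P.Down B) {r c : ℕ}
    (hs : r + c + 2 ≤ n) (h : B (P.west r (c + 1))) : B (P.west r c) := by
  cases hx : P.cross r c
  · rw [west_succ_elbow P hx] at h
    exact hB _ _ ⟨r, c, hs, hx, rfl, rfl⟩ h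
  · rwa [west_succ_cross P hx] at h

theorem down_west_le (P : PipeDream n) {B : ℕ → Prop} (hB : P.Down B) {r c c' : ℕ}
    (hc : c' ≤ c) (hs : r + c + 1 ≤ n) (h : B (P.west r c)) : B (P.west r c') := by
  induction c, hc using Nat.le_induction with
  | base => exact h
  | succ c hc ih => exact ih (by omega) (down_west P hB (by omega) h)

theorem down_north (P : PipeDream n) {B : ℕ → Prop} (hB : P.Down B) {r c : ℕ}
    (hs : r + c + 2 ≤ n) (h : B (P.south r c)) : B (P.north r c) := by
  cases hx : P.cross r c
  · rw [north_elbow P hx]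
    exact hB _ _ ⟨r, c, hs, hx, rfl, rfl⟩ h
  · rwa [north_cross P hx]

theorem down_south_le (P : PipeDream n) {B : ℕ → Prop} (hB : P.Down B) {r r' c : ℕ}
    (hr : r' ≤ r) (hs : r + c + 2 ≤ n) (h : B (P.south r c)) : B (P.south r' c) := by
  induction r, hr using Nat.le_induction with
  | base => exact h
  | succ r hr ih =>
    refine ih (by omega) ?_
    rw [south_eq P (by omega)]
    exact down_north P hB hs h

/-- last box of a row visited horizontally by `B` -/
def Outer (P : PipeDream n) (B : ℕ → Prop) (r c : ℕ) : Prop :=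
  r + c + 1 ≤ n ∧ P.cross r c = false ∧ B (P.west r c) ∧ (r + c + 2 ≤ n → ¬ B (P.south r c))

theorem exists_outer (P : PipeDream n) {B : ℕ → Prop} {r c : ℕ}
    (hs : r + c + 1 ≤ n) (h : B (P.west r c)) : ∃ e, c ≤ e ∧ P.Outer B r e := by
  induction hk : n - c generalizing c with
  | zero => omega
  | succ k ih =>
    by_cases ho : P.Outer B r c
    · exact ⟨c, le_rfl, ho⟩
    have h2 : r + c + 2 ≤ n ∧ B (P.west r (c + 1)) := by
      cases hx : P.cross r c
      · have : ¬ (r + c + 2 ≤ n → ¬ B (P.south r c)) := fun h3 => ho ⟨hs, hx, h, h3⟩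
        push Not at this
        rw [west_succ_elbow P hx]; exact this
      · rw [west_succ_cross P hx]; exact ⟨P.inShape _ _ hx, h⟩
    obtain ⟨e, h3, h4⟩ := ih (c := c + 1) (by omega) h2.2 (by omega)
    exact ⟨e, by omega, h4⟩

theorem outer_anti (P : PipeDream n) (hred : P.Reduced) {B : ℕ → Prop} (hB : P.Down B) :
    ∀ k r r2 c, r2 - r ≤ k → r < r2 → P.Outer B r c → r2 + c + 1 ≤ n →
      ¬ B (P.west r2 c) := by
  intro k
  induction k with
  | zero => intro r r2 c h1 h2; omega
  | succ k ih =>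
    intro r r2 c hk hr ho hs hb
    by_cases hex : ∃ r', r < r' ∧ r' < r2 ∧ B r'
    · obtain ⟨r', h1, h2, h3⟩ := hex
      have h4 := ih r r' c (by omega) h1 ho (by omega)
      obtain ⟨e, -, h5⟩ := exists_outer P (B := B) (r := r') (c := 0) (by omega)
        (by rwa [west_zero])
      have h6 : e < c := by
        by_contra h
        exact h4 (down_west_le P hB (by omega) h5.1 h5.2.2.1)
      exact ih r' r2 e (by omega) h2 h5 (by omega) (down_west_le P hB (by omega) hs hb)
    · push Not at hex
      obtain ⟨h1, h2, h3, h4⟩ := ho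
      have h4 := h4 (by omega)
      obtain ⟨e, g1, g2, g3, g4, g5⟩ := follow_east P hs rfl
      have hne : c < e := by
        rcases Nat.lt_or_ge c e with h | h
        · exact h
        · exfalso
          have hec : e = c := by omega
          rw [hec] at g3
          have : P.south (r2 - 1) c = P.west r2 c := by
            rw [south_eq P (by omega), show r2 - 1 + 1 = r2 by omega, north_elbow P g3]
          exact h4 (down_south_le P hB (r := r2 - 1) (by omega) (by omega) (by rwa [this]))
      have hA : ∀ r', r ≤ r' → r' < r2 → ¬ B (P.west r' e) := by
        intro r' f1 f2 f3
        by_cases hrr : r' = r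
        · rw [hrr] at f3
          have := down_west_le P hB (c' := c + 1) (by omega) (by omega) f3
          rw [west_succ_elbow P h2] at this
          exact h4 this
        · have := down_west_le P hB (c' := 0) (by omega) (by omega) f3
          rw [west_zero] at this
          exact hex r' (by omega) f2 this
      have hX : ∀ r', r ≤ r' → r' < r2 → P.south r' e = P.west r2 c → P.cross r' e = true := by
        intro r' f1 f2 f3
        by_contra hx
        have hx : P.cross r' e = false := by simpa using hx
        exact hA r' f1 f2 (hB _ _ ⟨r', e, by omega, hx, rfl, rfl⟩ (by rwa [f3]))
      have hcol : ∀ m r', r' + m + 1 = r2 → r ≤ r' → P.south r' e = P.west r2 c := by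
        intro m
        induction m with
        | zero =>
          intro r' f1 f2
          rw [south_eq P (by omega), show r' + 1 = r2 by omega, north_elbow P g3,
            g4 e g1 le_rfl]
        | succ m ihm =>
          intro r' f1 f2
          have f3 := ihm (r' + 1) (by omega) (by omega)
          rw [south_eq P (by omega), north_cross P (hX (r' + 1) (by omega) (by omega) f3), f3]
      have := hook_full P hred (b := P.west r2 c) hr g2 hne
        (fun c' f1 f2 => ⟨g5 c' f1 f2, g4 c' f1 (by omega)⟩)
        (fun r' f1 f2 =>
          have f3 := hcol (r2 - r' - 1) r' (by omega) f1
          ⟨hX r' f1 f2 f3, f3⟩)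
      rw [h2] at this
      exact Bool.false_ne_true this

theorem outer_south (P : PipeDream n) (hred : P.Reduced) {B : ℕ → Prop} (hB : P.Down B)
    {r c c' : ℕ} (ho : P.Outer B r c) (hs : r + c' + 2 ≤ n) (h : B (P.south r c')) : c' < c := by
  by_contra hc
  obtain ⟨r', h1, h2, h3⟩ := south_from P hs rfl
  rw [← h3] at h
  exact outer_anti P hred hB _ r r' c le_rfl h1 ho (by omega)
    (down_west_le P hB (by omega) h2 h)

end PipeDream

/-- Let `ω ∈ S_n` and let `i < j` be such that
`j - i ≤ #{k ≤ i : ω⁻¹ k < ω⁻¹ j}`.  Then in every acyclic reduced pipe dream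
`P ∈ Π(ω)`, the pipes `i` and `j` are comparable for `⪯_P` : either `i ⪯_P j` or
`j ⪯_P i`. -/
theorem pipes_comparable (n : ℕ) (ω : Equiv.Perm (Fin n)) (i j : Fin n)
    (hij : i < j)
    (hcount : j.val - i.val ≤
      (Finset.univ.filter (fun k : Fin n => k ≤ i ∧ ω⁻¹ k < ω⁻¹ j)).card)
    (P : PipeDream n)
    (hred : P.Reduced) (hexit : P.HasExitPerm ω) (hacyclic : P.Acyclic) :
    P.Path i.val j.val ∨ P.Path j.val i.val := by
  classical
  by_contra hcon
  push Not at hcon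
  obtain ⟨hn1, hn2⟩ := hcon
  have hijv : i.val < j.val := hij
  let B : ℕ → Prop := fun d => P.Path d i.val ∨ P.Path d j.val
  have hB : P.Down B := by
    intro x y hxy hy
    rcases hy with h | h
    · exact Or.inl (Relation.ReflTransGen.head hxy h)
    · exact Or.inr (Relation.ReflTransGen.head hxy h)
  have hBi : B i.val := Or.inl Relation.ReflTransGen.refl
  have hBj : B j.val := Or.inr Relation.ReflTransGen.refl
  have hsi : ∀ y, P.Arc i.val y → ¬ B y := by
    rintro y hy (h | h)
    · exact hacyclic _ (Relation.TransGen.head' hy h)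
    · exact hn1 (Relation.ReflTransGen.head hy h)
  have hsj : ∀ y, P.Arc j.val y → ¬ B y := by
    rintro y hy (h | h)
    · exact hn2 (Relation.ReflTransGen.head hy h)
    · exact hacyclic _ (Relation.TransGen.head' hy h)
  have hilt := i.isLt
  have hjlt := j.isLt
  -- pipe `i` runs straight to the corner `(i, κ)`
  obtain ⟨κ, -, k2, k3, k4, -⟩ := P.follow_east (r := i.val) (c := 0) (by omega) (P.west_zero _)
  have hκ : P.Outer B i.val κ := by
    refine ⟨k2, k3, ?_, fun h => ?_⟩
    · rw [k4 κ (by omega) le_rfl]; exact hBi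
    · exact hsi _ ⟨_, _, h, k3, k4 κ (by omega) le_rfl, rfl⟩
  -- pipe `j` enters row `i` at column `γ`
  obtain ⟨γ, -, g2, g3⟩ := P.up_to (c := 0) hijv (by omega) (P.west_zero _)
  have hγκ : γ < κ := P.outer_south hred hB hκ g2 (by rw [g3]; exact hBj)
  have hwi : P.west i.val γ = i.val := k4 γ (by omega) (by omega)
  have hxi : P.cross i.val γ = true := by
    by_contra hx
    have hx : P.cross i.val γ = false := by simpa using hx
    exact hn1 (Relation.ReflTransGen.single ⟨_, _, g2, hx, hwi, g3⟩)
  rcases P.straight_up g2 g3 with ⟨ρ, h1, h2, h3, -⟩ | hall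
  · have hρi : ρ < i.val := by
      rcases Nat.lt_or_ge ρ i.val with h | h
      · exact h
      · rw [show ρ = i.val by omega, hxi] at h2
        simp at h2
    obtain ⟨e, e1, e2, e3, e4, -⟩ := P.follow_east (r := ρ) (c := γ + 1) (p := j.val) (by omega)
      (by rw [P.west_succ_elbow h2, h3])
    have he : P.Outer B ρ e := by
      refine ⟨e2, e3, ?_, fun h => ?_⟩
      · rw [e4 e e1 le_rfl]; exact hBj
      · exact hsj _ ⟨_, _, h, e3, e4 e e1 le_rfl, rfl⟩
    obtain ⟨c', c1, c2, c3⟩ := P.up_to (c := κ) hρi k2 (k4 κ (by omega) le_rfl)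
    have hc' : c' < e := P.outer_south hred hB he c2 (by rw [c3]; exact hBi)
    have hwj : P.west ρ c' = j.val := e4 c' (by omega) (by omega)
    cases hx : P.cross ρ c'
    · exact hn2 (Relation.ReflTransGen.single ⟨_, _, c2, hx, hwj, c3⟩)
    · exact (P.cross_uniq hred hxi hx (by omega) hwi g3).2 ⟨hwj, c3⟩
  · have hord : ∀ q, q ≤ i.val → P.west q γ < j.val ∧
        ∀ a : Fin n, a.val = P.west q γ → ω⁻¹ j < ω⁻¹ a := by
      intro q hq
      obtain ⟨q1, q2⟩ := hall q hq
      obtain ⟨o1, l, l', o2, o3, o4, o5⟩ := P.cross_order hred q1 rfl q2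
      refine ⟨o1, fun a ha => ?_⟩
      have e1 := hexit ⟨l, by omega⟩
      have e2 := hexit ⟨l', o3⟩
      have f1 : ω ⟨l, by omega⟩ = j := Fin.ext (by rw [← e1]; exact o4)
      have f2 : ω ⟨l', o3⟩ = a := Fin.ext (by rw [← e2, ha]; exact o5)
      rw [← f1, ← f2]
      simpa using o2
    let S := Finset.univ.filter (fun k : Fin n => k ≤ i ∧ ω⁻¹ k < ω⁻¹ j)
    let T := Finset.univ.filter (fun k : Fin n => k < j ∧ ω⁻¹ j < ω⁻¹ k)
    have hT : i.val + 1 ≤ T.card := by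
      have : (Finset.range (i.val + 1)).card ≤ T.card := by
        refine Finset.card_le_card_of_injOn
          (fun q => if h : P.west q γ < n then (⟨P.west q γ, h⟩ : Fin n) else i) ?_ ?_
        · intro q hq
          have hq : q ≤ i.val := by
            have := Finset.mem_range.1 (Finset.mem_coe.1 hq); omega
          obtain ⟨o1, o2⟩ := hord q hq
          have hlt : P.west q γ < n := by omega
          simp only [hlt, dif_pos]
          exact Finset.mem_coe.2 (Finset.mem_filter.2 ⟨Finset.mem_univ _, o1, o2 _ rfl⟩)
        · intro q hq q' hq' heq
          have hq : q ≤ i.val := by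
            have := Finset.mem_range.1 (Finset.mem_coe.1 hq); omega
          have hq' : q' ≤ i.val := by
            have := Finset.mem_range.1 (Finset.mem_coe.1 hq'); omega
          have hlt : P.west q γ < n := by have := (hord q hq).1; omega
          have hlt' : P.west q' γ < n := by have := (hord q' hq').1; omega
          simp only [hlt, hlt', dif_pos, Fin.mk.injEq] at heq
          by_contra hne
          exact (P.cross_uniq hred (hall q hq).1 (hall q' hq').1 (Or.inl hne) rfl
            (hall q hq).2).1 ⟨heq.symm, (hall q' hq').2⟩
      simpa using this
    have hdis : Disjoint S T := by
      rw [Finset.disjoint_left]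
      intro a ha hb
      have h1 := (Finset.mem_filter.1 ha).2.2
      have h2 := (Finset.mem_filter.1 hb).2.2
      exact lt_asymm h1 h2
    have hsub : S ∪ T ⊆ Finset.Iio j := by
      intro a ha
      rw [Finset.mem_Iio]
      rcases Finset.mem_union.1 ha with h | h
      · exact lt_of_le_of_lt (Finset.mem_filter.1 h).2.1 hij
      · exact (Finset.mem_filter.1 h).2.1
    have hcard := Finset.card_le_card hsub
    rw [Finset.card_union_of_disjoint hdis, Fin.card_Iio] at hcard
    have hS : j.val - i.val ≤ S.card := hcount
    omega
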